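/- Consider Asymmetric LoRA gradient flow for matrix factorization with LSI (η_A = η, η_B = 0, A_0 = 0, B_0 ∈ ℝ^{b×r} arbitrary), and let P ∈ ℝ^{b×b} be the orthogonal projection onto the column space of B_0. Then the map t ↦ ‖X_t − M‖_F² is nonincreasing, for all t ≥ 0 one has ‖X_t − M‖_F² ≥ ‖M‖_F² − ‖PM‖_F², and ‖X_t − M‖_F² → ‖M‖_F² − ‖PM‖_F² as t → ∞. -/

import Mathlib

open Matrix MeasureTheory Filter Topology

noncomputable section

/-- The measurable space structure on matrices (the product σ-algebra). -/
instance matrixMeasurableSpace {m n : Type*} : MeasurableSpace (Matrix m n ℝ) :=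
  show MeasurableSpace (m → n → ℝ) from inferInstance

/-- Squared Frobenius norm of a real matrix. -/
def fnormSq {m n : ℕ} (M : Matrix (Fin m) (Fin n) ℝ) : ℝ := ∑ i, ∑ j, M i j ^ 2

/-- Frobenius norm of a real matrix. -/
def fnorm {m n : ℕ} (M : Matrix (Fin m) (Fin n) ℝ) : ℝ := Real.sqrt (fnormSq M)

/-- `X = (α/r) • B Aᵀ`, the LoRA update associated with adapters `A`, `B`. -/
def lX {a b r : ℕ} (α : ℝ) (A : Matrix (Fin a) (Fin r) ℝ) (B : Matrix (Fin b) (Fin r) ℝ) :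
    Matrix (Fin b) (Fin a) ℝ := (α / (r : ℝ)) • (B * Aᵀ)

/-- `Y = (α/r) • A Aᵀ`. -/
def lY {a r : ℕ} (α : ℝ) (A : Matrix (Fin a) (Fin r) ℝ) : Matrix (Fin a) (Fin a) ℝ :=
  (α / (r : ℝ)) • (A * Aᵀ)

/-- `Z = (α/r) • B Bᵀ`. -/
def lZ {b r : ℕ} (α : ℝ) (B : Matrix (Fin b) (Fin r) ℝ) : Matrix (Fin b) (Fin b) ℝ :=
  (α / (r : ℝ)) • (B * Bᵀ)

/-- `G = (α/r) • (X - M)`, the gradient of the matrix-factorization loss. -/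
def lG {a b r : ℕ} (α : ℝ) (M : Matrix (Fin b) (Fin a) ℝ) (A : Matrix (Fin a) (Fin r) ℝ)
    (B : Matrix (Fin b) (Fin r) ℝ) : Matrix (Fin b) (Fin a) ℝ :=
  (α / (r : ℝ)) • (lX α A B - M)

/-- The LoRA gradient flow on `[0, ∞)` for the matrix-factorization objective, with learning
rates `ηA` for the adapter `A` and `ηB` for the adapter `B`:
`dA/dt = -ηA Gᵀ B`, `dB/dt = -ηB G A`, stated entrywise. -/
def LoraFlow {a b r : ℕ} (α ηA ηB : ℝ) (M : Matrix (Fin b) (Fin a) ℝ)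
    (A : ℝ → Matrix (Fin a) (Fin r) ℝ) (B : ℝ → Matrix (Fin b) (Fin r) ℝ) : Prop :=
  ∀ t, (0 : ℝ) ≤ t →
    (∀ i j, HasDerivAt (fun s => A s i j) (((-ηA) • ((lG α M (A t) (B t))ᵀ * B t)) i j) t) ∧
    (∀ i j, HasDerivAt (fun s => B s i j) (((-ηB) • (lG α M (A t) (B t) * A t)) i j) t)

/-- The rectangular `b × a` diagonal matrix with diagonal entries `σ 0, σ 1, …`. -/
def svdDiag (b a : ℕ) (σ : ℕ → ℝ) : Matrix (Fin b) (Fin a) ℝ :=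
  Matrix.of fun i j => if (i : ℕ) = (j : ℕ) then σ (i : ℕ) else 0

/-- `M = U Σ Vᵀ` is a singular value decomposition of `M` with (nonincreasing, nonnegative)
singular values `σ 0 ≥ σ 1 ≥ …`, so that `σ i` is the `(i+1)`-th largest singular value,
the columns of `U` are corresponding left singular vectors and the columns of `V` are
corresponding right singular vectors. -/
def IsSVD {b a : ℕ} (M : Matrix (Fin b) (Fin a) ℝ) (U : Matrix (Fin b) (Fin b) ℝ)
    (V : Matrix (Fin a) (Fin a) ℝ) (σ : ℕ → ℝ) : Prop :=
  U * Uᵀ = 1 ∧ Uᵀ * U = 1 ∧ V * Vᵀ = 1 ∧ Vᵀ * V = 1 ∧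
    (∀ i j, i ≤ j → σ j ≤ σ i) ∧ (∀ i, 0 ≤ σ i) ∧ (∀ i, min a b ≤ i → σ i = 0) ∧
    M = U * svdDiag b a σ * Vᵀ

theorem fnormSq_eq_trace {m n : ℕ} (X : Matrix (Fin m) (Fin n) ℝ) :
    fnormSq X = (Xᵀ * X).trace := by
  simp only [fnormSq, Matrix.trace, Matrix.diag, Matrix.mul_apply, Matrix.transpose_apply]
  rw [Finset.sum_comm]
  simp [sq]

theorem sum_mul_eq_trace {m n : ℕ} (X Y : Matrix (Fin m) (Fin n) ℝ) :
    ∑ i, ∑ j, X i j * Y i j = (Xᵀ * Y).trace := by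
  simp only [Matrix.trace, Matrix.diag, Matrix.mul_apply, Matrix.transpose_apply]
  rw [Finset.sum_comm]

theorem fnormSq_nonneg' {m n : ℕ} (X : Matrix (Fin m) (Fin n) ℝ) : 0 ≤ fnormSq X := by
  unfold fnormSq; positivity

theorem fnormSq_mul_le {l m n : ℕ} (X : Matrix (Fin l) (Fin m) ℝ)
    (Y : Matrix (Fin m) (Fin n) ℝ) : fnormSq (X * Y) ≤ fnormSq X * fnormSq Y := by
  have h : fnormSq Y = ∑ j, ∑ k, Y k j ^ 2 := by rw [fnormSq, Finset.sum_comm]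
  rw [h]
  unfold fnormSq
  rw [Finset.sum_mul]
  refine Finset.sum_le_sum fun i _ => ?_
  rw [Finset.mul_sum]
  refine Finset.sum_le_sum fun j _ => ?_
  rw [Matrix.mul_apply]
  exact Finset.sum_mul_sq_le_sq_mul_sq _ _ _

theorem flow_B_const {a b r : ℕ} {α η : ℝ} {M : Matrix (Fin b) (Fin a) ℝ}
    {A : ℝ → Matrix (Fin a) (Fin r) ℝ} {B : ℝ → Matrix (Fin b) (Fin r) ℝ}
    (hflow : LoraFlow α η 0 M A B) (t : ℝ) (ht : 0 ≤ t) : B t = B 0 := by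
  ext i j
  have hd : ∀ s, 0 ≤ s → HasDerivAt (fun s => B s i j) 0 s := by
    intro s hs
    simpa using (hflow s hs).2 i j
  have := constant_of_has_deriv_right_zero (f := fun s => B s i j) (a := 0) (b := t)
    (fun s hs => (hd s hs.1).continuousAt.continuousWithinAt)
    (fun s hs => (hd s hs.1).hasDerivWithinAt)
  exact this t ⟨ht, le_rfl⟩

theorem flow_R_deriv {a b r : ℕ} {α η : ℝ} {M : Matrix (Fin b) (Fin a) ℝ}
    {A : ℝ → Matrix (Fin a) (Fin r) ℝ} {B : ℝ → Matrix (Fin b) (Fin r) ℝ}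
    (hflow : LoraFlow α η 0 M A B) (t : ℝ) (ht : 0 ≤ t) (i : Fin b) (j : Fin a) :
    HasDerivAt (fun s => (lX α (A s) (B s) - M) i j)
      (((-(η * (α / r) ^ 2)) • (B t * ((B t)ᵀ * (lX α (A t) (B t) - M)))) i j) t := by
  have hk : ∀ k ∈ Finset.univ, HasDerivAt (fun s => B s i k * A s j k)
      (B t i k * (((-η) • ((lG α M (A t) (B t))ᵀ * B t)) j k)) t := by
    intro k _
    have hB : HasDerivAt (fun s => B s i k) 0 t := by simpa using (hflow t ht).2 i k
    exact (hB.fun_mul ((hflow t ht).1 j k)).congr_deriv (by ring)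
  have h := ((HasDerivAt.fun_sum hk).const_mul (α / r)).sub_const (M i j)
  have e1 : (fun s => (lX α (A s) (B s) - M) i j) =
      fun s => (α / r) * ∑ k, B s i k * A s j k - M i j := by
    funext s
    simp [lX, Matrix.mul_apply]
  rw [e1]
  refine h.congr_deriv ?_
  symm
  generalize hR : lX α (A t) (B t) - M = R
  rw [Matrix.smul_apply, Matrix.mul_apply, smul_eq_mul, Finset.mul_sum, Finset.mul_sum]
  simp only [lG, hR]
  refine Finset.sum_congr rfl fun k _ => ?_
  simp only [Matrix.mul_apply, Matrix.transpose_apply, Matrix.smul_apply, smul_eq_mul,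
    Finset.mul_sum]
  refine Finset.sum_congr rfl fun l _ => ?_
  ring

theorem flow_L_deriv {a b r : ℕ} {α η : ℝ} {M : Matrix (Fin b) (Fin a) ℝ}
    {A : ℝ → Matrix (Fin a) (Fin r) ℝ} {B : ℝ → Matrix (Fin b) (Fin r) ℝ}
    (hflow : LoraFlow α η 0 M A B) (t : ℝ) (ht : 0 ≤ t) :
    HasDerivAt (fun s => fnormSq (lX α (A s) (B s) - M))
      (-(2 * (η * (α / r) ^ 2)) * fnormSq ((B t)ᵀ * (lX α (A t) (B t) - M))) t := by
  have h := HasDerivAt.fun_sum (u := Finset.univ) fun i _ =>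
    HasDerivAt.fun_sum (u := Finset.univ) fun j _ => (flow_R_deriv hflow t ht i j).fun_pow 2
  unfold fnormSq at *
  refine h.congr_deriv ?_
  change _ = _ * fnormSq _
  generalize lX α (A t) (B t) - M = R
  rw [fnormSq_eq_trace, Matrix.transpose_mul, Matrix.transpose_transpose, Matrix.mul_assoc,
    ← sum_mul_eq_trace, Finset.mul_sum]
  refine Finset.sum_congr rfl fun i _ => ?_
  rw [Finset.mul_sum]
  refine Finset.sum_congr rfl fun j _ => ?_
  simp only [Matrix.smul_apply, smul_eq_mul]
  push_cast
  ring

theorem fnormSq_proj {a b : ℕ} (P : Matrix (Fin b) (Fin b) ℝ) (hs : Pᵀ = P) (hi : P * P = P)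
    (X : Matrix (Fin b) (Fin a) ℝ) : fnormSq (X - P * X) = fnormSq X - fnormSq (P * X) := by
  have h1 : Xᵀ * P * (P * X) = Xᵀ * P * X := by
    rw [Matrix.mul_assoc, ← Matrix.mul_assoc P, hi, Matrix.mul_assoc]
  simp only [fnormSq_eq_trace, Matrix.transpose_sub, Matrix.transpose_mul, hs, Matrix.sub_mul,
    Matrix.mul_sub, h1, Matrix.trace_sub, Matrix.mul_assoc]
  ring

/-- For Asymmetric LoRA gradient flow with LSI (`ηA = η`, `ηB = 0`,
`A₀ = 0`, `B₀` arbitrary), with `P` the orthogonal projection onto the column space of `B₀`: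
`t ↦ ‖Xₜ - M‖_F²` is nonincreasing on `[0, ∞)`, is bounded below by `‖M‖_F² - ‖PM‖_F²`,
and tends to `‖M‖_F² - ‖PM‖_F²` as `t → ∞`. -/
theorem statement11
    (a b r : ℕ) (hr0 : 0 < r) (hr : r ≤ min a b)
    (α η : ℝ) (hα : 0 < α) (hη : 0 < η)
    (M : Matrix (Fin b) (Fin a) ℝ)
    (A : ℝ → Matrix (Fin a) (Fin r) ℝ) (B : ℝ → Matrix (Fin b) (Fin r) ℝ)
    (hA0 : A 0 = 0)
    (hflow : LoraFlow α η 0 M A B)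
    (P : Matrix (Fin b) (Fin b) ℝ) (hPsymm : Pᵀ = P) (hPidem : P * P = P)
    (hPrange : LinearMap.range P.mulVecLin = LinearMap.range (B 0).mulVecLin) :
    (∀ s t : ℝ, 0 ≤ s → s ≤ t →
      fnormSq (lX α (A t) (B t) - M) ≤ fnormSq (lX α (A s) (B s) - M)) ∧
    (∀ t : ℝ, 0 ≤ t →
      fnormSq M - fnormSq (P * M) ≤ fnormSq (lX α (A t) (B t) - M)) ∧
    Tendsto (fun t => fnormSq (lX α (A t) (B t) - M)) atTop
      (𝓝 (fnormSq M - fnormSq (P * M))) := by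
  have hc : 0 < α / (r : ℝ) := div_pos hα (by exact_mod_cast hr0)
  have hB := flow_B_const hflow
  have hL := flow_L_deriv hflow
  set L : ℝ → ℝ := fun t => fnormSq (lX α (A t) (B t) - M) with hLdef
  set k : ℝ := 2 * (η * (α / r) ^ 2) with hk
  have hk0 : 0 < k := by positivity
  -- `P` fixes `B 0`, and `P` factors through `B 0`
  have hPB : P * B 0 = B 0 := by
    ext i j
    have hm : (B 0).mulVecLin (Pi.single j 1) ∈ LinearMap.range P.mulVecLin := by
      rw [hPrange]; exact ⟨_, rfl⟩
    obtain ⟨v, hv⟩ := hm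
    have hv' : P *ᵥ v = B 0 *ᵥ Pi.single j 1 := hv
    have h2 : P *ᵥ (B 0 *ᵥ Pi.single j 1) = B 0 *ᵥ Pi.single j 1 := by
      rw [← hv', Matrix.mulVec_mulVec, hPidem]
    rw [Matrix.mulVec_mulVec] at h2
    simpa using congrFun h2 i
  have hfac : ∃ C : Matrix (Fin r) (Fin b) ℝ, P = B 0 * C := by
    have hm : ∀ j, ∃ w : Fin r → ℝ, B 0 *ᵥ w = P *ᵥ Pi.single j 1 := by
      intro j
      have : P.mulVecLin (Pi.single j 1) ∈ LinearMap.range (B 0).mulVecLin := by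
        rw [← hPrange]; exact ⟨_, rfl⟩
      obtain ⟨w, hw⟩ := this
      exact ⟨w, hw⟩
    choose w hw using hm
    refine ⟨Matrix.of fun i j => w j i, ?_⟩
    ext i j
    have := congrFun (hw j) i
    simp only [Matrix.mulVec_single_one, Matrix.col_apply] at this
    rw [← this]
    rfl
  obtain ⟨C, hC⟩ := hfac
  have hPC : P = Cᵀ * (B 0)ᵀ := by
    rw [← Matrix.transpose_mul, ← hC, hPsymm]
  -- decomposition of the loss
  have hdec : ∀ t, 0 ≤ t → L t = fnormSq (P * (lX α (A t) (B t) - M)) +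
      (fnormSq M - fnormSq (P * M)) := by
    intro t ht
    have h1 := fnormSq_proj P hPsymm hPidem (lX α (A t) (B t) - M)
    have h2 := fnormSq_proj P hPsymm hPidem M
    have h3 : (lX α (A t) (B t) - M) - P * (lX α (A t) (B t) - M) = -(M - P * M) := by
      have : P * lX α (A t) (B t) = lX α (A t) (B t) := by
        rw [hB t ht, lX, Matrix.mul_smul, ← Matrix.mul_assoc, hPB]
      rw [Matrix.mul_sub, this]
      abel
    have h4 : fnormSq (-(M - P * M)) = fnormSq (M - P * M) := by
      rw [fnormSq_eq_trace, fnormSq_eq_trace, Matrix.transpose_neg, Matrix.neg_mul, Matrix.mul_neg, neg_neg]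
    rw [h3, h4, h2] at h1
    change fnormSq _ = _
    linarith
  have hlow : ∀ t, 0 ≤ t → fnormSq M - fnormSq (P * M) ≤ L t := by
    intro t ht
    rw [hdec t ht]
    linarith [fnormSq_nonneg' (P * (lX α (A t) (B t) - M))]
  have hmono : AntitoneOn L (Set.Ici 0) := by
    refine antitoneOn_of_deriv_nonpos (convex_Ici 0)
      (fun t ht => (hL t ht).continuousAt.continuousWithinAt) ?_ ?_
    · intro t ht
      rw [interior_Ici] at ht
      exact (hL t (le_of_lt ht)).differentiableAt.differentiableWithinAt
    · intro t ht
      rw [interior_Ici] at ht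
      rw [(hL t (le_of_lt ht)).deriv]
      nlinarith [fnormSq_nonneg' ((B t)ᵀ * (lX α (A t) (B t) - M))]
  refine ⟨fun s t hs hst => hmono hs (le_trans hs hst) hst, hlow, ?_⟩
  set m : ℝ := fnormSq M - fnormSq (P * M) with hm
  set K : ℝ := fnormSq Cᵀ + 1 with hK
  have hK0 : 0 < K := by linarith [fnormSq_nonneg' Cᵀ]
  have hcoer : ∀ t, 0 ≤ t → L t - m ≤ K * fnormSq ((B t)ᵀ * (lX α (A t) (B t) - M)) := by
    intro t ht
    have h1 := fnormSq_mul_le Cᵀ ((B t)ᵀ * (lX α (A t) (B t) - M))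
    rw [← Matrix.mul_assoc] at h1
    nth_rewrite 1 [hB t ht] at h1
    rw [← hPC] at h1
    have h2 := hdec t ht
    have h3 := fnormSq_nonneg' ((B t)ᵀ * (lX α (A t) (B t) - M))
    rw [hK]
    linarith
  have hd : ∀ t, 0 ≤ t → HasDerivAt (fun t => (L t - m) * Real.exp (k / K * t))
      ((-k * fnormSq ((B t)ᵀ * (lX α (A t) (B t) - M))) * Real.exp (k / K * t) +
        (L t - m) * (Real.exp (k / K * t) * (k / K))) t := by
    intro t ht
    have he : HasDerivAt (fun t => Real.exp (k / K * t)) (Real.exp (k / K * t) * (k / K)) t := by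
      simpa using ((hasDerivAt_id t).const_mul (k / K)).exp
    exact ((hL t ht).sub_const m).mul he
  have hanti : AntitoneOn (fun t => (L t - m) * Real.exp (k / K * t)) (Set.Ici 0) := by
    refine antitoneOn_of_deriv_nonpos (convex_Ici 0)
      (fun t ht => (hd t ht).continuousAt.continuousWithinAt) ?_ ?_
    · intro t ht
      rw [interior_Ici] at ht
      exact (hd t (le_of_lt ht)).differentiableAt.differentiableWithinAt
    · intro t ht
      rw [interior_Ici] at ht
      rw [(hd t (le_of_lt ht)).deriv]
      have h1 := hcoer t (le_of_lt ht)
      have h2 : (L t - m) * (k / K) ≤ k * fnormSq ((B t)ᵀ * (lX α (A t) (B t) - M)) := by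
        calc (L t - m) * (k / K)
            ≤ (K * fnormSq ((B t)ᵀ * (lX α (A t) (B t) - M))) * (k / K) :=
              mul_le_mul_of_nonneg_right h1 (by positivity)
          _ = _ := by field_simp
      have h3 := Real.exp_pos (k / K * t)
      nlinarith
  have hub : ∀ t, 0 ≤ t → L t ≤ m + (L 0 - m) * Real.exp (-(k / K * t)) := by
    intro t ht
    have h := hanti (Set.mem_Ici.2 le_rfl) (Set.mem_Ici.2 ht) ht
    simp only [mul_zero, Real.exp_zero, mul_one] at h
    have h3 := Real.exp_pos (k / K * t)
    rw [Real.exp_neg, ← div_eq_mul_inv]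
    have := (le_div_iff₀ h3).2 h
    linarith
  have hlim : Tendsto (fun t => m + (L 0 - m) * Real.exp (-(k / K * t))) atTop (𝓝 m) := by
    have h1 : Tendsto (fun t : ℝ => k / K * t) atTop atTop :=
      tendsto_id.const_mul_atTop (by positivity)
    have h2 := ((Real.tendsto_exp_neg_atTop_nhds_zero.comp h1).const_mul (L 0 - m)).const_add m
    simpa using h2
  refine tendsto_of_tendsto_of_tendsto_of_le_of_le' tendsto_const_nhds hlim ?_ ?_
  · filter_upwards [eventually_ge_atTop 0] with t ht using hlow t ht
  · filter_upwards [eventually_ge_atTop 0] with t ht using hub t ht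

end
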